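/- Let k ≥ 1 with k ≡ 2 (mod 4) and h ∈ ℤ with 0 ≤ h < k and gcd(h,k) = 1. Then lim_{t→0⁺} B(q(t)) = i ∑_{n=0}^{k/2 − 1} (−1)^{n(n+1)/2} ζ_k^{hn(n+1)} (ζ_k^{2h};−ζ_k^{2h})_n / (iζ_k^h;−ζ_k^{2h})_{n+1}², and all denominators of this finite sum are nonzero. -/

import Mathlib

open scoped BigOperators Classical
open Filter Topology

noncomputable section

/-- finite q-Pochhammer symbol $(x;q)_n$ -/
def qPoch (x q : ℂ) (n : ℕ) : ℂ := ∏ j ∈ Finset.range n, (1 - x * q ^ j)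

/-- infinite q-Pochhammer symbol $(x;q)_\infty$ -/
def qPochInf (x q : ℂ) : ℂ := ∏' j : ℕ, (1 - x * q ^ j)

/-- $e(x) = e^{2\pi i x}$ -/
def ee (x : ℂ) : ℂ := Complex.exp (2 * Real.pi * Complex.I * x)

/-- $\zeta_n^m = e(m/n)$ -/
def zeta (m : ℤ) (n : ℕ) : ℂ := ee ((m : ℂ) / (n : ℂ))

/-- Dedekind eta -/
def eta (τ : ℂ) : ℂ := Complex.exp (Real.pi * Complex.I * τ / 12) * qPochInf (ee τ) (ee τ)

/-- Jacobi theta -/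
def theta (z τ : ℂ) : ℂ :=
  -Complex.I * Complex.exp (Real.pi * Complex.I * τ / 4) * Complex.exp (-(Real.pi * Complex.I * z))
    * qPochInf (ee τ) (ee τ) * qPochInf (ee z) (ee τ) * qPochInf ((ee z)⁻¹ * ee τ) (ee τ)

/-- universal mock theta function g₂ -/
def g2 (ζ q : ℂ) : ℂ :=
  ∑' n : ℕ, qPoch (-q) q n * q ^ (n * (n + 1) / 2) /
    (qPoch ζ q (n + 1) * qPoch (ζ⁻¹ * q) q (n + 1))

/-- universal mock theta function g₃ -/
def g3 (ζ q : ℂ) : ℂ :=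
  ∑' n : ℕ, q ^ (n * (n + 1)) / (qPoch ζ q (n + 1) * qPoch (ζ⁻¹ * q) q (n + 1))

/-- the series L -/
def Lser (ζ q : ℂ) : ℂ :=
  (1 / 2) * ∑' n : ℕ, q ^ n * qPoch (ζ⁻¹ * q) q n * qPoch ζ q n / qPoch (-q) q n

/-- the function M -/
def Mfun (z τ : ℂ) : ℂ :=
  -(Complex.I / 2) * Complex.exp (Real.pi * Complex.I * z) * theta z τ *
    g3 (-(ee z)) (ee τ) / (Complex.exp (Real.pi * Complex.I * τ / 12) * eta (2 * τ))

/-- the function T -/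
def Tfun (z τ : ℂ) : ℂ :=
  -Complex.I * eta (2 * τ) ^ 4 / (ee z * eta τ ^ 2 * theta (2 * z) (2 * τ))
  - Complex.I * eta (2 * τ) ^ 10 * theta (2 * z + 1 / 2) (2 * τ) /
      (2 * ee z ^ 2 * Complex.exp (Real.pi * Complex.I * τ / 2) * eta τ ^ 4 * eta (4 * τ) ^ 4 *
        theta (2 * z) (2 * τ) * theta (2 * z + τ + 1 / 2) (2 * τ))
  - Complex.I * eta (2 * τ) ^ 4 * theta z τ /
      (2 * Complex.exp (Real.pi * Complex.I * τ / 2) * ee z ^ 2 * eta (4 * τ) ^ 2 *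
        theta (z + 1 / 2) τ * theta (2 * z + τ + 1 / 2) (2 * τ))

/-- the function K -/
def Kfun (z τ : ℂ) : ℂ :=
  eta (2 * τ) ^ 4 / (Complex.I * ee z * eta τ ^ 2 * theta (2 * z) (2 * τ))

/-- Zwegers' μ-function -/
def mu (z₁ z₂ τ : ℂ) : ℂ :=
  Complex.exp (Real.pi * Complex.I * z₁) / theta z₂ τ *
    ∑' n : ℤ, (-(ee z₂)) ^ n * Complex.exp (Real.pi * Complex.I * (n : ℂ) * ((n : ℂ) + 1) * τ) /
      (1 - ee z₁ * (ee τ) ^ n)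

/-- the Appell–Lerch sum A -/
def appell (ζ q : ℂ) : ℂ :=
  ∑' n : ℤ, (-1 : ℂ) ^ n * q ^ ((3 * n * (n + 1)) / 2) / (1 + ζ * q ^ n)

/-- the function Θ -/
def bigTheta (z₁ z₂ z τ : ℂ) : ℂ :=
  (1 / (2 * Real.pi * Complex.I)) * deriv (fun w => theta w τ) 0 *
    theta (z₁ + z₂ + z) τ * theta z τ /
    (theta z₁ τ * theta z₂ τ * theta (z₁ + z) τ * theta (z₂ + z) τ)

/-- the function 𝔱 -/
def tfrak (z τ : ℂ) : ℂ :=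
  Kfun z τ - Complex.I * Kfun (z + 1 / 4) (τ + 1 / 2) +
    Complex.I * Complex.exp (-(Real.pi * Complex.I * τ / 2)) * bigTheta (2 * z) τ (1 / 2) (2 * τ)

/-- the second order mock theta function B -/
def mockB (q : ℂ) : ℂ :=
  ∑' n : ℕ, q ^ n * qPoch (-q) (q ^ 2) n / qPoch q (q ^ 2) (n + 1)

/-- Ramanujan's third order mock theta function f -/
def mockf (q : ℂ) : ℂ := ∑' n : ℕ, q ^ (n ^ 2) / qPoch (-q) q n ^ 2

/-- the modular form b -/
def bfun (q : ℂ) : ℂ := qPochInf q q / qPochInf (-q) q ^ 2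

/-- τ(t) = h/k + it/(2π) -/
def tauT (h k : ℕ) (t : ℝ) : ℂ := (h : ℂ) / (k : ℂ) + Complex.I * (t : ℂ) / (2 * Real.pi)

/-- q(t) = e^{2πiτ(t)} -/
def qT (h k : ℕ) (t : ℝ) : ℂ := ee (tauT h k t)

lemma qPoch_zero (x q : ℂ) : qPoch x q 0 = 1 := by simp [qPoch]

lemma qPoch_succ (x q : ℂ) (n : ℕ) : qPoch x q (n + 1) = qPoch x q n * (1 - x * q ^ n) := by
  simp [qPoch, Finset.prod_range_succ]

lemma qPoch_add (x q : ℂ) (n m : ℕ) :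
    qPoch x q (n + m) = qPoch x q n * qPoch (x * q ^ n) q m := by
  simp only [qPoch, Finset.prod_range_add, pow_add, mul_assoc]

lemma qPoch_succ' (x q : ℂ) (n : ℕ) : qPoch x q (n + 1) = (1 - x) * qPoch (x * q) q n := by
  rw [add_comm, qPoch_add, qPoch_succ, qPoch_zero]
  simp

lemma qPoch_ne_zero {x q : ℂ} (h : ∀ j, x * q ^ j ≠ 1) (n : ℕ) : qPoch x q n ≠ 0 :=
  Finset.prod_ne_zero_iff.mpr fun j _ ↦ sub_ne_zero.mpr (h j).symm

lemma qPoch_eq_zero {x q : ℂ} {j n : ℕ} (hj : j < n) (h : x * q ^ j = 1) : qPoch x q n = 0 :=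
  Finset.prod_eq_zero (Finset.mem_range.mpr hj) (by rw [h, sub_self])

lemma qPoch_eq_one_sub_pow {p : ℂ} {K : ℕ} (hp : IsPrimitiveRoot p K) (hK : 0 < K) (z : ℂ) :
    qPoch z p K = 1 - z ^ K := by
  have h := hp.pow_sub_pow_eq_prod_sub_mul 1 z hK
  rw [one_pow] at h
  rw [h, qPoch]
  refine Finset.prod_nbij (fun i ↦ p ^ i) ?_ ?_ ?_ ?_
  · intro i _
    rw [Polynomial.mem_nthRootsFinset hK, ← pow_mul, mul_comm, pow_mul, hp.pow_eq_one, one_pow]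
  · intro i hi j hj hij
    exact hp.pow_inj (by simpa using hi) (by simpa using hj) hij
  · intro x hx
    rw [Finset.mem_coe, Polynomial.mem_nthRootsFinset hK] at hx
    have : NeZero K := ⟨hK.ne'⟩
    obtain ⟨i, hi, rfl⟩ := hp.eq_pow_of_pow_eq_one hx
    exact ⟨i, by simpa using hi, rfl⟩
  · intro i _
    ring

/-- The truncation to `K` terms of the series `∑ (p/x)^n (-x;p)_n / (x;p)_{n+1}`. -/
def lambertSum (K : ℕ) (p x : ℂ) : ℂ :=
  ∑ n ∈ Finset.range K, (p / x) ^ n * qPoch (-x) p n / qPoch x p (n + 1)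

/-- The truncation to `K` terms of the series defining `g2 x p`. -/
def eulerSum (K : ℕ) (p x : ℂ) : ℂ :=
  ∑ n ∈ Finset.range K, p ^ (n * (n + 1) / 2) * qPoch (-p) p n /
    (qPoch x p (n + 1) * qPoch (p / x) p (n + 1))

lemma lambertSum_partial {p x : ℂ} (hx : x ≠ 0) (h : ∀ j, x * p ^ j ≠ 1) (hp : p ≠ 0) (N : ℕ) :
    lambertSum (N + 1) p (x * p) + x ^ 2 * lambertSum (N + 1) p x =
      -x + x⁻¹ ^ N * qPoch (-(x * p)) p N * (1 - x ^ 2 * p ^ (N + 1)) / qPoch x p (N + 2) := by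
  have hne : ∀ j, 1 - x * p ^ j ≠ 0 := fun j ↦ sub_ne_zero.mpr (h j).symm
  have hx1 : 1 - x ≠ 0 := by simpa using hne 0
  have hdiv : p / (x * p) = x⁻¹ := by field_simp
  induction N with
  | zero =>
    have h1 := hne 1
    simp only [pow_one] at h1
    simp only [lambertSum, zero_add, Finset.sum_range_one, qPoch_succ, qPoch_zero, pow_zero,
      pow_one, mul_one, one_mul]
    field_simp
    ring
  | succ N ih =>
    have h1 := hne (N + 1)
    have h2 := hne (N + 2)
    have h3 := qPoch_ne_zero h (N + 1)
    have e1 : qPoch (x * p) p (N + 2) =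
        qPoch x p (N + 1) * (1 - x * p ^ (N + 1)) * (1 - x * p ^ (N + 2)) / (1 - x) := by
      rw [eq_div_iff hx1, mul_comm, ← qPoch_succ', qPoch_succ, qPoch_succ]
    have e2 : qPoch (-x) p (N + 1) = (1 + x) * qPoch (-(x * p)) p N := by
      rw [qPoch_succ', sub_neg_eq_add, neg_mul]
    rw [lambertSum, lambertSum, Finset.sum_range_succ, Finset.sum_range_succ _ (N + 1),
      ← lambertSum, ← lambertSum, mul_add, add_add_add_comm, ih, hdiv, e1, e2,
      qPoch_succ x p (N + 2), qPoch_succ x p (N + 1), qPoch_succ (-(x * p)) p N,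
      div_eq_mul_inv p x, mul_pow p, pow_succ x⁻¹ N]
    rw [pow_succ p (N + 1), ← mul_assoc] at h2
    rw [pow_succ p (N + 1), ← mul_assoc x]
    have e3 : -(x * p) * p ^ N = -(x * p ^ (N + 1)) := by ring
    rw [e3]
    generalize x⁻¹ ^ N = X
    generalize p ^ (N + 1) = Y at *
    generalize qPoch x p (N + 1) = A at *
    generalize hD : 1 - x * Y * p = D at *
    field_simp
    rw [← hD]
    ring

lemma lambertSum_mul {p x : ℂ} {K : ℕ} (hx : x ≠ 0) (h : ∀ j, x * p ^ j ≠ 1) (hK : 0 < K)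
    (hpK : p ^ K = 1) (hv : qPoch (-x) p K = 0) :
    lambertSum K p (x * p) = -x - x ^ 2 * lambertSum K p x := by
  obtain ⟨N, rfl⟩ : ∃ N, K = N + 1 := ⟨K - 1, by omega⟩
  have hp : p ≠ 0 := by
    rintro rfl
    simp at hpK
  have e := lambertSum_partial hx h hp N
  have h0 : qPoch (-(x * p)) p N * (1 - x ^ 2 * p ^ (N + 1)) = 0 := by
    rw [qPoch_succ', sub_neg_eq_add, neg_mul] at hv
    rw [hpK]
    linear_combination (1 - x) * hv
  rw [mul_assoc, h0] at e
  linear_combination e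

lemma triangle_succ (n : ℕ) : (n + 1) * (n + 1 + 1) / 2 = n * (n + 1) / 2 + (n + 1) := by
  rw [show (n + 1) * (n + 1 + 1) = n * (n + 1) + (n + 1) * 2 by ring,
    Nat.add_mul_div_right _ _ two_pos]

lemma eulerSum_partial {p x : ℂ} (hx : x ≠ 0) (hp : p ≠ 0) (h : ∀ j, x * p ^ j ≠ 1)
    (h' : ∀ j, p ^ j ≠ x) (N : ℕ) :
    eulerSum N p (x * p) + x ^ 2 * eulerSum N p x =
      x * (p ^ (N * (N + 1) / 2) * qPoch (-p) p N / (qPoch (x * p) p N * qPoch (p / x) p N))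
        - x := by
  have hne : ∀ j, 1 - x * p ^ j ≠ 0 := fun j ↦ sub_ne_zero.mpr (h j).symm
  have hx1 : 1 - x ≠ 0 := by simpa using hne 0
  have hne' : ∀ j, x - p ^ j ≠ 0 := fun j ↦ sub_ne_zero.mpr (h' j).symm
  have hx1' : x - 1 ≠ 0 := by simpa using hne' 0
  have hdiv : p / (x * p) = x⁻¹ := by field_simp
  induction N with
  | zero => simp [eulerSum, qPoch_zero]
  | succ N ih =>
    have h1 := hne (N + 1)
    have h2 := hne' (N + 1)
    have h3 : qPoch (x * p) p N ≠ 0 := qPoch_ne_zero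
      (fun j hj ↦ h (j + 1) (by rw [← hj]; ring)) N
    have h4 : qPoch (p / x) p N ≠ 0 := qPoch_ne_zero
      (fun j hj ↦ h' (j + 1) (by rw [div_mul_eq_mul_div, div_eq_iff hx] at hj; rw [pow_succ', hj, one_mul])) N
    have e1 : qPoch x⁻¹ p (N + 1) = (1 - x⁻¹) * qPoch (p / x) p N := by
      rw [qPoch_succ', inv_mul_eq_div]
    have e2 : 1 - p / x * p ^ N = (x - p ^ (N + 1)) / x := by
      field_simp
      ring
    have e3 : 1 - x * p * p ^ N = 1 - x * p ^ (N + 1) := by ring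
    have e4 : 1 - x⁻¹ = (x - 1) / x := by field_simp
    rw [eulerSum, eulerSum, Finset.sum_range_succ, Finset.sum_range_succ _ N,
      ← eulerSum, ← eulerSum, mul_add (x ^ 2), add_add_add_comm, ih, hdiv, e1, triangle_succ,
      qPoch_succ' x, qPoch_succ, qPoch_succ, qPoch_succ, e2, e3, e4,
      pow_add p (N * (N + 1) / 2), neg_mul, ← pow_succ' p N]
    generalize p ^ (N * (N + 1) / 2) = A
    generalize p ^ (N + 1) = Y at *
    field_simp
    ring

lemma eulerSum_mul {p x : ℂ} {K : ℕ} (hx : x ≠ 0) (hp : p ≠ 0) (h : ∀ j, x * p ^ j ≠ 1)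
    (h' : ∀ j, p ^ j ≠ x) (hv : qPoch (-p) p K = 0) :
    eulerSum K p (x * p) = -x - x ^ 2 * eulerSum K p x := by
  have e := eulerSum_partial hx hp h h' K
  rw [hv] at e
  linear_combination e

lemma eq_pow_mul_of_succ {d : ℕ → ℂ} {x p : ℂ} (h : ∀ n, d (n + 1) = -(x * p ^ n) ^ 2 * d n)
    (n : ℕ) : d n = (-1) ^ n * x ^ (2 * n) * p ^ (n * (n - 1)) * d 0 := by
  induction n with
  | zero => simp
  | succ n ih =>
    have e : (n + 1) * (n + 1 - 1) = n * (n - 1) + n * 2 := by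
      cases n with
      | zero => rfl
      | succ m => simp only [Nat.add_sub_cancel]; ring
    rw [h, ih, e, pow_add p, pow_mul p n 2]
    ring

lemma pow_mul_pred_eq_one {p : ℂ} {K : ℕ} (hK : Odd K) (hp : p ^ (2 * K) = 1) :
    p ^ (K * (K - 1)) = 1 := by
  obtain ⟨m, rfl⟩ := hK
  rw [Nat.add_sub_cancel, show (2 * m + 1) * (2 * m) = 2 * (2 * m + 1) * m by ring, pow_mul, hp,
    one_pow]

lemma eulerSum_neg_of_norm_ne_one {p x : ℂ} {K : ℕ} (hK : Odd K) (hpK : p ^ K = -1) (hx : x ≠ 0)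
    (hx1 : ‖x‖ ≠ 1) : eulerSum K p (-x) = -eulerSum K p x := by
  have hK0 : 0 < K := hK.pos
  have hp : p ≠ 0 := by
    rintro rfl
    simp [hK0.ne'] at hpK
  have hp2 : p ^ (2 * K) = 1 := by rw [mul_comm, pow_mul, hpK]; norm_num
  have hpn : ‖p‖ = 1 := by
    have : ‖p‖ ^ K = 1 := by rw [← norm_pow, hpK]; simp
    exact (pow_eq_one_iff_of_nonneg (norm_nonneg _) hK0.ne').mp this
  have hv : qPoch (-p) p K = 0 := qPoch_eq_zero (j := K - 1) (by omega) (by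
    rw [neg_mul, ← pow_succ', Nat.sub_add_cancel hK0, hpK, neg_neg])
  have hrec : ∀ y : ℂ, ‖y‖ = ‖x‖ → eulerSum K p (y * p) = -y - y ^ 2 * eulerSum K p y := by
    intro y hy
    refine eulerSum_mul ?_ hp ?_ ?_ hv
    · rw [← norm_ne_zero_iff, hy]
      exact norm_ne_zero_iff.mpr hx
    · intro j hj
      apply hx1
      simpa [hpn, hy] using congrArg norm hj
    · intro j hj
      apply hx1
      simpa [hpn, hy] using (congrArg norm hj).symm
  have hs := eq_pow_mul_of_succ
    (d := fun n ↦ eulerSum K p (x * p ^ n) + eulerSum K p (-(x * p ^ n))) (x := x) (p := p)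
    (fun n ↦ by
      have e1 := hrec (x * p ^ n) (by simp [hpn])
      have e2 := hrec (-(x * p ^ n)) (by simp [hpn])
      have e3 : x * p ^ (n + 1) = x * p ^ n * p := by ring
      simp only [e3]
      rw [← neg_mul, e1, e2]
      ring) K
  simp only [hpK, pow_zero, mul_one, mul_neg, neg_neg, hK.neg_one_pow,
    pow_mul_pred_eq_one hK hp2] at hs
  have hfac : (1 + x ^ (2 * K)) * (eulerSum K p x + eulerSum K p (-x)) = 0 := by
    linear_combination hs
  rcases mul_eq_zero.mp hfac with h0 | h0
  · exfalso
    apply hx1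
    have : ‖x‖ ^ (2 * K) = 1 := by
      rw [← norm_pow, eq_neg_of_add_eq_zero_right h0]
      simp
    exact (pow_eq_one_iff_of_nonneg (norm_nonneg _) (by omega)).mp this
  · linear_combination h0

lemma eulerSum_neg {p x : ℂ} {K : ℕ} (hK : Odd K) (hpK : p ^ K = -1) (hx : x ^ (2 * K) = -1) :
    eulerSum K p (-x) = -eulerSum K p x := by
  have hK0 : 0 < K := hK.pos
  have hp2 : p ^ (2 * K) = 1 := by rw [mul_comm, pow_mul, hpK]; norm_num
  have hx0 : x ≠ 0 := by
    rintro rfl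
    simp [hK0.ne'] at hx
  have hxn : ‖x‖ = 1 := by
    have : ‖x‖ ^ (2 * K) = 1 := by rw [← norm_pow, hx]; simp
    exact (pow_eq_one_iff_of_nonneg (norm_nonneg _) (by omega)).mp this
  have hpj : ∀ j, (p ^ j) ^ (2 * K) = 1 := fun j ↦ by
    rw [← pow_mul, mul_comm, pow_mul, hp2, one_pow]
  have hev : Even (2 * K) := even_two_mul K
  have hcont : ∀ y : ℂ, y ^ (2 * K) = -1 → ContinuousAt (eulerSum K p) y := by
    intro y hy
    have hy0 : y ≠ 0 := by
      rintro rfl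
      simp [hK0.ne'] at hy
    have h1 : ∀ n, qPoch y p n ≠ 0 := qPoch_ne_zero fun j hj ↦ by
      have := congrArg (· ^ (2 * K)) hj
      norm_num [mul_pow, hpj, hy] at this
    have h2 : ∀ n, qPoch (p / y) p n ≠ 0 := qPoch_ne_zero fun j hj ↦ by
      have := congrArg (· ^ (2 * K)) hj
      norm_num [mul_pow, div_pow, hp2, hpj, hy] at this
    have c1 : ∀ n, ContinuousAt (fun z ↦ qPoch z p n) y := fun n ↦ by
      unfold qPoch
      fun_prop
    have c2 : ∀ n, ContinuousAt (fun z ↦ qPoch (p / z) p n) y := fun n ↦ by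
      unfold qPoch
      fun_prop (disch := assumption)
    unfold eulerSum
    refine tendsto_finsetSum _ fun n _ ↦ ?_
    exact tendsto_const_nhds.div ((c1 _).mul (c2 _)) (mul_ne_zero (h1 _) (h2 _))
  have hray : Tendsto (fun r : ℝ ↦ x * (r : ℂ)) (𝓝[>] 1) (𝓝 x) := by
    have : Continuous (fun r : ℝ ↦ x * (r : ℂ)) := by fun_prop
    simpa using (this.tendsto 1).mono_left nhdsWithin_le_nhds
  have t1 := (hcont x hx).tendsto.comp hray
  have t2 := ((hcont (-x) (by rw [hev.neg_pow, hx])).tendsto.comp hray.neg).neg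
  refine (neg_eq_iff_eq_neg.mp (tendsto_nhds_unique (t2.congr' ?_) t1))
  filter_upwards [self_mem_nhdsWithin] with r hr
  have hr : (1 : ℝ) < r := hr
  simp only [Function.comp_apply]
  rw [eulerSum_neg_of_norm_ne_one hK hpK (mul_ne_zero hx0 (by exact_mod_cast (by positivity)))
    (by rw [norm_mul, hxn, one_mul, Complex.norm_real, Real.norm_of_nonneg (by positivity)];
        exact hr.ne'), neg_neg]

theorem lambertSum_eq_eulerSum {q : ℂ} {K : ℕ} (hK : Odd K) (hq : IsPrimitiveRoot q (2 * K)) :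
    lambertSum K (q ^ 2) q = Complex.I * eulerSum K (-q ^ 2) (Complex.I * q) := by
  have hK0 : 0 < K := hK.pos
  have hq0 : q ≠ 0 := hq.ne_zero (by omega)
  have hqK : q ^ K = -1 := by
    have h1 : (q ^ K) ^ 2 = 1 := by rw [← pow_mul, mul_comm, hq.pow_eq_one]
    exact (sq_eq_one_iff.mp h1).resolve_left (hq.pow_ne_one_of_pos_of_lt hK0.ne' (by omega))
  have hp1 : (q ^ 2) ^ K = 1 := by rw [← pow_mul, hq.pow_eq_one]
  have hP : (-q ^ 2) ^ K = -1 := by rw [hK.neg_pow, hp1]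
  have hP2 : (-q ^ 2) ^ (2 * K) = 1 := by rw [mul_comm, pow_mul, hP]; norm_num
  have hw : (Complex.I * q) ^ (2 * K) = -1 := by
    rw [mul_pow, hq.pow_eq_one, pow_mul, Complex.I_sq, hK.neg_one_pow, mul_one]
  have hPj : ∀ j, ((-q ^ 2) ^ j) ^ (2 * K) = 1 := fun j ↦ by
    rw [← pow_mul, mul_comm, pow_mul, hP2, one_pow]
  obtain ⟨m, hm⟩ := hK
  have hodd : ∀ j, q ^ (2 * j + 1) ≠ 1 := fun j hj ↦ by
    have := (dvd_mul_right 2 K).trans (hq.dvd_of_pow_eq_one _ hj)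
    omega
  have hy : ∀ n, lambertSum K (q ^ 2) (q * (q ^ 2) ^ (n + 1)) =
      -(q * (q ^ 2) ^ n) - (q * (q ^ 2) ^ n) ^ 2 * lambertSum K (q ^ 2) (q * (q ^ 2) ^ n) := by
    intro n
    rw [pow_succ (q ^ 2) n, ← mul_assoc]
    refine lambertSum_mul (by positivity) ?_ hK0 hp1 ?_
    · intro j hj
      apply hodd (n + j)
      rw [← hj]
      ring
    · have := qPoch_eq_one_sub_pow (hq.pow (by omega) rfl) hK0 (-(q * (q ^ 2) ^ n))
      rw [this, Odd.neg_pow ⟨m, hm⟩, mul_pow, hqK, ← pow_mul _ n, mul_comm n, pow_mul _ K, hp1]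
      simp
  have hz : ∀ n, eulerSum K (-q ^ 2) (Complex.I * q * (-q ^ 2) ^ (n + 1)) =
      -(Complex.I * q * (-q ^ 2) ^ n) - (Complex.I * q * (-q ^ 2) ^ n) ^ 2 *
        eulerSum K (-q ^ 2) (Complex.I * q * (-q ^ 2) ^ n) := by
    intro n
    rw [pow_succ (-q ^ 2) n, ← mul_assoc]
    refine eulerSum_mul ?_ (by simpa using hq0) ?_ ?_ ?_
    · simp [hq0]
    · intro j hj
      have := congrArg (· ^ (2 * K)) hj
      norm_num [mul_pow _ _ (2 * K), hPj, hw] at this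
      norm_num [← mul_pow, hw] at this
    · intro j hj
      have := congrArg (· ^ (2 * K)) hj
      norm_num [mul_pow _ _ (2 * K), hPj, hw] at this
      norm_num [← mul_pow, hw] at this
    · exact qPoch_eq_zero (j := K - 1) (by omega) (by
        rw [neg_mul, ← pow_succ', Nat.sub_add_cancel hK0, hP, neg_neg])
  have hd := eq_pow_mul_of_succ (x := q) (p := q ^ 2)
    (d := fun n ↦ lambertSum K (q ^ 2) (q * (q ^ 2) ^ n) -
      Complex.I * (-1) ^ n * eulerSum K (-q ^ 2) (Complex.I * q * (-q ^ 2) ^ n))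
    (fun n ↦ by
      rw [hy, hz]
      have hs : ((-1 : ℂ) ^ n) ^ 2 = 1 := by rw [← pow_mul, mul_comm, pow_mul]; norm_num
      rw [neg_pow (q ^ 2) n, pow_succ (-1 : ℂ) n]
      generalize (-1 : ℂ) ^ n = s at *
      generalize eulerSum K (-q ^ 2) _ = E
      linear_combination (-(q * (q ^ 2) ^ n) - (q * (q ^ 2) ^ n) ^ 2 * Complex.I * s * E) *
        (s ^ 2 * Complex.I_sq - hs)) K
  simp only [hp1, hP, pow_zero, mul_one, mul_neg, Odd.neg_one_pow ⟨m, hm⟩, hq.pow_eq_one,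
    pow_mul_pred_eq_one (p := q ^ 2) ⟨m, hm⟩ (by rw [mul_comm, pow_mul, hp1, one_pow]),
    eulerSum_neg ⟨m, hm⟩ hP hw] at hd
  linear_combination hd / 2

/-- The `n`-th term of the series defining `mockB q`. -/
def mockBTerm (q : ℂ) (n : ℕ) : ℂ := q ^ n * qPoch (-q) (q ^ 2) n / qPoch q (q ^ 2) (n + 1)

lemma mockBTerm_add (q : ℂ) (n K : ℕ) : mockBTerm q (n + K) =
    q ^ K * qPoch (-q ^ (2 * n + 1)) (q ^ 2) K / qPoch (q ^ (2 * (n + 1) + 1)) (q ^ 2) K *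
      mockBTerm q n := by
  have e1 : -q * (q ^ 2) ^ n = -q ^ (2 * n + 1) := by ring
  have e2 : q * (q ^ 2) ^ (n + 1) = q ^ (2 * (n + 1) + 1) := by ring
  rw [mockBTerm, mockBTerm, show n + K + 1 = n + 1 + K by ring, qPoch_add, qPoch_add, e1, e2,
    pow_add, div_mul_div_comm]
  congr 1 <;> ring

lemma norm_prod_range_sub_prod_range_le {f g : ℕ → ℂ} (hf : ∀ i, ‖f i‖ ≤ 2) (hg : ∀ i, ‖g i‖ ≤ 2)
    (K : ℕ) : ‖∏ i ∈ Finset.range K, f i - ∏ i ∈ Finset.range K, g i‖ ≤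
      2 ^ K * ∑ i ∈ Finset.range K, ‖f i - g i‖ := by
  induction K with
  | zero => simp
  | succ K ih =>
    rw [Finset.prod_range_succ, Finset.prod_range_succ, Finset.sum_range_succ]
    set F := ∏ i ∈ Finset.range K, f i with hF
    set G := ∏ i ∈ Finset.range K, g i
    have hFn : ‖F‖ ≤ 2 ^ K := by
      rw [hF, norm_prod]
      calc _ ≤ ∏ i ∈ Finset.range K, (2 : ℝ) :=
            Finset.prod_le_prod (fun _ _ ↦ norm_nonneg _) fun i _ ↦ hf i
        _ = 2 ^ K := by simp
    have h0 : (0 : ℝ) ≤ 2 ^ K := by positivity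
    calc ‖F * f K - G * g K‖ = ‖F * (f K - g K) + (F - G) * g K‖ := by ring_nf
      _ ≤ ‖F‖ * ‖f K - g K‖ + ‖F - G‖ * ‖g K‖ := by
        refine (norm_add_le _ _).trans ?_
        rw [norm_mul, norm_mul]
      _ ≤ 2 ^ K * ‖f K - g K‖ + (2 ^ K * ∑ i ∈ Finset.range K, ‖f i - g i‖) * 2 := by
        gcongr
        exact hg K
      _ ≤ _ := by
        rw [pow_succ]
        nlinarith [mul_nonneg h0 (norm_nonneg (f K - g K))]

lemma norm_qPoch_sub_le {p z : ℂ} {K : ℕ} (hp : IsPrimitiveRoot p K) (hK : 0 < K) (hz : ‖z‖ ≤ 1)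
    {t : ℝ} (ht : 0 ≤ t) :
    ‖qPoch z (p * (Real.exp (-t) : ℂ) ^ 2) K - (1 - z ^ K)‖ ≤ 2 ^ K * (2 * K ^ 2) * t * ‖z‖ := by
  have hpn : ‖p‖ = 1 := by
    have : ‖p‖ ^ K = 1 := by rw [← norm_pow, hp.pow_eq_one]; simp
    exact (pow_eq_one_iff_of_nonneg (norm_nonneg _) hK.ne').mp this
  have hr0 : 0 ≤ Real.exp (-t) := (Real.exp_pos _).le
  have hr1 : Real.exp (-t) ≤ 1 := Real.exp_le_one_iff.mpr (by linarith)
  have hle : ∀ w : ℂ, ‖w‖ ≤ 1 → ‖1 - z * w‖ ≤ 2 := fun w hw ↦ by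
    have := norm_sub_le (1 : ℂ) (z * w)
    rw [norm_mul, norm_one] at this
    nlinarith [norm_nonneg z, norm_nonneg w]
  rw [← qPoch_eq_one_sub_pow hp hK]
  refine (norm_prod_range_sub_prod_range_le (fun i ↦ hle _ ?_) (fun i ↦ hle _ ?_) K).trans ?_
  · rw [norm_pow, norm_mul, hpn, one_mul, norm_pow, Complex.norm_real, Real.norm_of_nonneg hr0]
    exact pow_le_one₀ (by positivity) (pow_le_one₀ hr0 hr1)
  · simp [hpn]
  · have hterm : ∀ i ∈ Finset.range K, ‖(1 - z * (p * (Real.exp (-t) : ℂ) ^ 2) ^ i) -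
        (1 - z * p ^ i)‖ ≤ ‖z‖ * (2 * t * K) := by
      intro i hi
      have hi : (i : ℝ) ≤ K := by exact_mod_cast (Finset.mem_range.mp hi).le
      have e : (1 - z * (p * (Real.exp (-t) : ℂ) ^ 2) ^ i) - (1 - z * p ^ i) =
          z * p ^ i * ((1 - (Real.exp (-t) ^ 2) ^ i : ℝ) : ℂ) := by
        push_cast
        ring
      have e2 : (Real.exp (-t) ^ 2) ^ i = Real.exp (-(2 * t * i)) := by
        rw [← Real.exp_nat_mul, ← Real.exp_nat_mul]
        congr 1
        push_cast
        ring
      have h1 := Real.add_one_le_exp (-(2 * t * i))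
      have h2 : Real.exp (-(2 * t * i)) ≤ 1 := Real.exp_le_one_iff.mpr (by
        have : 0 ≤ 2 * t * i := by positivity
        linarith)
      rw [e, norm_mul, norm_mul, norm_pow, hpn, one_pow, mul_one, Complex.norm_real, e2,
        Real.norm_of_nonneg (by linarith)]
      gcongr
      calc 1 - Real.exp (-(2 * t * i)) ≤ 2 * t * i := by linarith
        _ ≤ 2 * t * K := by gcongr
    calc 2 ^ K * ∑ i ∈ Finset.range K, ‖(1 - z * (p * (Real.exp (-t) : ℂ) ^ 2) ^ i) -
          (1 - z * p ^ i)‖ ≤ 2 ^ K * (K * (‖z‖ * (2 * t * K))) := by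
          gcongr
          simpa using Finset.sum_le_card_nsmul _ _ _ hterm
      _ = _ := by ring

lemma sum_range_le_of_norm_add_le {a : ℕ → ℂ} {K : ℕ} {ρ : ℝ} (hρ : ρ < 1)
    (h : ∀ n, ‖a (n + K)‖ ≤ ρ * ‖a n‖) (N : ℕ) :
    ∑ n ∈ Finset.range N, ‖a n‖ ≤ (∑ n ∈ Finset.range K, ‖a n‖) / (1 - ρ) := by
  rw [le_div_iff₀ (by linarith)]
  have h1 : ∑ n ∈ Finset.range N, ‖a n‖ ≤ ∑ n ∈ Finset.range (K + N), ‖a n‖ :=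
    Finset.sum_le_sum_of_subset_of_nonneg (Finset.range_subset_range.mpr (by omega))
      fun _ _ _ ↦ norm_nonneg _
  rw [Finset.sum_range_add] at h1
  have h2 : ∑ n ∈ Finset.range N, ‖a (K + n)‖ ≤ ρ * ∑ n ∈ Finset.range N, ‖a n‖ := by
    rw [Finset.mul_sum]
    exact Finset.sum_le_sum fun n _ ↦ by rw [add_comm]; exact h n
  linarith

section RadialLimit

variable {ζ : ℂ} {K : ℕ}

lemma pow_half_eq_neg_one (hK : 0 < K) (hζ : IsPrimitiveRoot ζ (2 * K)) : ζ ^ K = -1 := by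
  have h1 : (ζ ^ K) ^ 2 = 1 := by rw [← pow_mul, mul_comm, hζ.pow_eq_one]
  exact (sq_eq_one_iff.mp h1).resolve_left (hζ.pow_ne_one_of_pos_of_lt hK.ne' (by omega))

lemma norm_mul_exp_pow (hK : 0 < K) (hζ : IsPrimitiveRoot ζ (2 * K)) (t : ℝ) (m : ℕ) :
    ‖(ζ * (Real.exp (-t) : ℂ)) ^ m‖ = Real.exp (-(m * t)) := by
  rw [norm_pow, norm_mul, hζ.norm'_eq_one (by omega), one_mul, Complex.norm_real,
    Real.norm_of_nonneg (Real.exp_pos _).le, ← Real.exp_nat_mul]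
  congr 1
  ring

lemma mul_exp_pow_pow (hK : 0 < K) (hζ : IsPrimitiveRoot ζ (2 * K)) (t : ℝ) (n : ℕ) :
    ((ζ * (Real.exp (-t) : ℂ)) ^ (2 * n + 1)) ^ K =
      -((Real.exp (-((2 * n + 1 : ℕ) * t)) ^ K : ℝ) : ℂ) := by
  have e : Real.exp (-((2 * n + 1 : ℕ) * t)) = Real.exp (-t) ^ (2 * n + 1) := by
    rw [← Real.exp_nat_mul]
    congr 1
    ring
  rw [e, mul_pow, mul_pow, ← pow_mul ζ, mul_comm _ K, pow_mul ζ, pow_half_eq_neg_one hK hζ,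
    Odd.neg_one_pow ⟨n, rfl⟩]
  push_cast
  ring

lemma norm_qPoch_neg_le (hK : Odd K) (hζ : IsPrimitiveRoot ζ (2 * K)) {t : ℝ} (ht : 0 ≤ t)
    (n : ℕ) :
    ‖qPoch (-(ζ * (Real.exp (-t) : ℂ)) ^ (2 * n + 1)) ((ζ * (Real.exp (-t) : ℂ)) ^ 2) K‖ ≤
      1 - Real.exp (-((2 * n + 1 : ℕ) * t)) ^ K +
        2 ^ K * (2 * K ^ 2) * t * Real.exp (-((2 * n + 1 : ℕ) * t)) := by
  have hy1 : Real.exp (-((2 * n + 1 : ℕ) * t)) ≤ 1 := Real.exp_le_one_iff.mpr (by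
    have : 0 ≤ ((2 * n + 1 : ℕ) : ℝ) * t := by positivity
    linarith)
  have hb := norm_qPoch_sub_le (hζ.pow (by have := hK.pos; omega) rfl) hK.pos
    (z := -(ζ * (Real.exp (-t) : ℂ)) ^ (2 * n + 1))
    (by rw [norm_neg, norm_mul_exp_pow hK.pos hζ]; exact hy1) ht
  rw [← mul_pow ζ, norm_neg, norm_mul_exp_pow hK.pos hζ, hK.neg_pow, mul_exp_pow_pow hK.pos hζ,
    neg_neg] at hb
  have hn : ‖(1 : ℂ) - ((Real.exp (-((2 * n + 1 : ℕ) * t)) ^ K : ℝ) : ℂ)‖ =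
      1 - Real.exp (-((2 * n + 1 : ℕ) * t)) ^ K := by
    rw [← Complex.ofReal_one, ← Complex.ofReal_sub, Complex.norm_real, Real.norm_of_nonneg]
    have := pow_le_one₀ (n := K) (Real.exp_pos _).le hy1
    linarith
  have := norm_sub_norm_le
    (qPoch (-(ζ * (Real.exp (-t) : ℂ)) ^ (2 * n + 1)) ((ζ * (Real.exp (-t) : ℂ)) ^ 2) K)
    (1 - ((Real.exp (-((2 * n + 1 : ℕ) * t)) ^ K : ℝ) : ℂ))
  linarith

lemma le_norm_qPoch (hK : Odd K) (hζ : IsPrimitiveRoot ζ (2 * K)) {t : ℝ} (ht : 0 ≤ t)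
    (n : ℕ) :
    1 + Real.exp (-((2 * n + 1 : ℕ) * t)) ^ K -
        2 ^ K * (2 * K ^ 2) * t * Real.exp (-((2 * n + 1 : ℕ) * t)) ≤
    ‖qPoch ((ζ * (Real.exp (-t) : ℂ)) ^ (2 * n + 1)) ((ζ * (Real.exp (-t) : ℂ)) ^ 2) K‖ := by
  have hy1 : Real.exp (-((2 * n + 1 : ℕ) * t)) ≤ 1 := Real.exp_le_one_iff.mpr (by
    have : 0 ≤ ((2 * n + 1 : ℕ) : ℝ) * t := by positivity
    linarith)
  have hb := norm_qPoch_sub_le (hζ.pow (by have := hK.pos; omega) rfl) hK.pos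
    (z := (ζ * (Real.exp (-t) : ℂ)) ^ (2 * n + 1))
    (by rw [norm_mul_exp_pow hK.pos hζ]; exact hy1) ht
  rw [← mul_pow ζ, norm_mul_exp_pow hK.pos hζ, mul_exp_pow_pow hK.pos hζ, sub_neg_eq_add] at hb
  have hn : ‖(1 : ℂ) + ((Real.exp (-((2 * n + 1 : ℕ) * t)) ^ K : ℝ) : ℂ)‖ =
      1 + Real.exp (-((2 * n + 1 : ℕ) * t)) ^ K := by
    rw [← Complex.ofReal_one, ← Complex.ofReal_add, Complex.norm_real, Real.norm_of_nonneg]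
    positivity
  have := norm_sub_norm_le
    (1 + ((Real.exp (-((2 * n + 1 : ℕ) * t)) ^ K : ℝ) : ℂ))
    (qPoch ((ζ * (Real.exp (-t) : ℂ)) ^ (2 * n + 1)) ((ζ * (Real.exp (-t) : ℂ)) ^ 2) K)
  rw [norm_sub_rev] at this
  linarith

lemma norm_mockBTerm_add_le (hK : Odd K) (hζ : IsPrimitiveRoot ζ (2 * K)) :
    ∀ᶠ t : ℝ in 𝓝[>] 0, ∀ n, ‖mockBTerm (ζ * (Real.exp (-t) : ℂ)) (n + K)‖ ≤
      (1 - t / 4) * ‖mockBTerm (ζ * (Real.exp (-t) : ℂ)) n‖ := by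
  set C : ℝ := 2 ^ K * (2 * K ^ 2) with hC
  have hK1 : (1 : ℝ) ≤ K := by exact_mod_cast hK.pos
  have hC0 : 0 < C := by positivity
  set ε : ℝ := 1 / (16 * C) with hε
  have hε0 : 0 < ε := by positivity
  have hCε : C * ε = 1 / 16 := by rw [hε]; field_simp
  have hδ : 0 < min (1 / 4) (ε ^ K / C) := by positivity
  filter_upwards [Ioo_mem_nhdsGT hδ] with t ht n
  obtain ⟨ht0, ht1⟩ := ht
  have ht4 : t < 1 / 4 := ht1.trans_le (min_le_left _ _)
  have htC : C * t ≤ ε ^ K := by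
    have := (ht1.trans_le (min_le_right _ _)).le
    rwa [le_div_iff₀ hC0, mul_comm] at this
  have hN := norm_qPoch_neg_le hK hζ ht0.le n
  have hD := le_norm_qPoch hK hζ ht0.le (n + 1)
  rw [← hC] at hN hD
  set y : ℝ := Real.exp (-((2 * n + 1 : ℕ) * t)) with hy
  set y' : ℝ := Real.exp (-((2 * (n + 1) + 1 : ℕ) * t)) with hy'
  have hy0 : 0 < y := Real.exp_pos _
  have hy0' : 0 < y' := Real.exp_pos _
  have hyy : y' ≤ y := Real.exp_le_exp.mpr (by push_cast; nlinarith)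
  have hy1 : y ≤ 1 := Real.exp_le_one_iff.mpr (by
    have : 0 ≤ ((2 * n + 1 : ℕ) : ℝ) * t := by positivity
    linarith)
  have hyy2 : y ≤ 2 * y' := by
    have e : y' = Real.exp (-(2 * t)) * y := by
      rw [hy, hy', ← Real.exp_add]
      congr 1
      push_cast
      ring
    have := Real.add_one_le_exp (-(2 * t))
    rw [e]
    nlinarith
  have hq : ‖(ζ * (Real.exp (-t) : ℂ)) ^ K‖ ≤ 1 - t / 2 := by
    rw [norm_mul_exp_pow hK.pos hζ, Real.exp_neg]
    have h1 := Real.add_one_le_exp (K * t)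
    refine inv_le_of_inv_le₀ (by linarith) ?_
    refine le_trans ?_ h1
    rw [inv_le_iff_one_le_mul₀ (by linarith)]
    have hKt : t ≤ K * t := by nlinarith
    nlinarith [mul_nonneg (sub_nonneg.mpr hKt) (show (0 : ℝ) ≤ 1 - t / 2 by linarith)]
  rw [mockBTerm_add, norm_mul, norm_div, norm_mul]
  refine mul_le_mul_of_nonneg_right ?_ (norm_nonneg _)
  have hN0 := norm_nonneg
    (qPoch (-(ζ * (Real.exp (-t) : ℂ)) ^ (2 * n + 1)) ((ζ * (Real.exp (-t) : ℂ)) ^ 2) K)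
  have hyK : 0 < y ^ K := by positivity
  have hyK' : 0 < y' ^ K := by positivity
  have hCt : 0 < C * t := by positivity
  rcases le_or_gt ε y' with hcase | hcase
  · have h1 : ε ^ K ≤ y' ^ K := pow_le_pow_left₀ hε0.le hcase K
    have h2 : ε ^ K ≤ y ^ K := pow_le_pow_left₀ hε0.le (hcase.trans hyy) K
    have hN1 := hN.trans (show _ ≤ (1 : ℝ) by nlinarith)
    have hD1 := (show (1 : ℝ) ≤ _ by nlinarith).trans hD
    rw [div_le_iff₀ (by linarith)]
    nlinarith [mul_le_mul hq hN1 hN0 (by linarith)]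
  · have h1 : C * t * y' ≤ t / 16 := by nlinarith
    have h2 : C * t * y ≤ t / 8 := by nlinarith
    have hN1 := hN.trans (show _ ≤ 1 + t / 8 by linarith)
    have hD1 := (show 1 - t / 16 ≤ _ by linarith).trans hD
    rw [div_le_iff₀ (by linarith)]
    nlinarith [mul_le_mul hq hN1 hN0 (by linarith)]

lemma norm_mockBTerm_add_le_mul (hK : Odd K) (hζ : IsPrimitiveRoot ζ (2 * K)) (n : ℕ) :
    ∃ c : ℝ, ∀ᶠ t : ℝ in 𝓝[>] 0, ‖mockBTerm (ζ * (Real.exp (-t) : ℂ)) (n + K)‖ ≤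
      c * t * ‖mockBTerm (ζ * (Real.exp (-t) : ℂ)) n‖ := by
  set C : ℝ := 2 ^ K * (2 * K ^ 2) with hC
  have hK1 : (1 : ℝ) ≤ K := by exact_mod_cast hK.pos
  have hC0 : 0 < C := by positivity
  refine ⟨2 * (K * (2 * n + 1 : ℕ) + C), ?_⟩
  have hδ : 0 < 1 / (2 * C) := by positivity
  filter_upwards [Ioo_mem_nhdsGT hδ] with t ht
  obtain ⟨ht0, ht1⟩ := ht
  rw [lt_div_iff₀ (by positivity)] at ht1
  have hN := norm_qPoch_neg_le hK hζ ht0.le n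
  have hD := le_norm_qPoch hK hζ ht0.le (n + 1)
  rw [← hC] at hN hD
  have hle : ∀ m : ℕ, Real.exp (-(m * t)) ≤ 1 := fun m ↦ Real.exp_le_one_iff.mpr (by
    have : 0 ≤ (m : ℝ) * t := by positivity
    linarith)
  have hq : ‖(ζ * (Real.exp (-t) : ℂ)) ^ K‖ ≤ 1 := by
    rw [norm_mul_exp_pow hK.pos hζ]
    exact hle K
  have hyK : 1 - K * ((2 * n + 1 : ℕ) * t) ≤ Real.exp (-((2 * n + 1 : ℕ) * t)) ^ K := by
    rw [← Real.exp_nat_mul]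
    have := Real.add_one_le_exp (K * -((2 * n + 1 : ℕ) * t))
    linarith
  have hyK' : 0 < Real.exp (-((2 * (n + 1) + 1 : ℕ) * t)) ^ K := by positivity
  have hy1 := hle (2 * n + 1)
  have hy1' := hle (2 * (n + 1) + 1)
  rw [mockBTerm_add, norm_mul, norm_div, norm_mul]
  refine mul_le_mul_of_nonneg_right ?_ (norm_nonneg _)
  set N := ‖qPoch (-(ζ * (Real.exp (-t) : ℂ)) ^ (2 * n + 1)) ((ζ * (Real.exp (-t) : ℂ)) ^ 2) K‖
  have hN0 : 0 ≤ N := norm_nonneg _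
  have hCt : 0 < C * t := by positivity
  have hN1 : N ≤ (K * (2 * n + 1 : ℕ) + C) * t := by nlinarith
  have hD1 := (show (1 : ℝ) / 2 ≤ _ by nlinarith).trans hD
  rw [div_le_iff₀ (by linarith)]
  calc _ ≤ 1 * ((K * (2 * n + 1 : ℕ) + C) * t) := by gcongr
    _ = 2 * (K * (2 * n + 1 : ℕ) + C) * t * (1 / 2) := by ring
    _ ≤ _ := by gcongr

lemma tendsto_mockBTerm (hζ : IsPrimitiveRoot ζ (2 * K)) (n : ℕ) :
    Tendsto (fun t : ℝ ↦ mockBTerm (ζ * (Real.exp (-t) : ℂ)) n) (𝓝[>] 0) (𝓝 (mockBTerm ζ n)) := by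
  have hne : qPoch ζ (ζ ^ 2) (n + 1) ≠ 0 := qPoch_ne_zero (fun j hj ↦ by
    have h1 : ζ ^ (2 * j + 1) = 1 := by rw [← hj]; ring
    have := (dvd_mul_right 2 K).trans (hζ.dvd_of_pow_eq_one _ h1)
    omega) _
  have hc : ContinuousAt (fun t : ℝ ↦ mockBTerm (ζ * (Real.exp (-t) : ℂ)) n) 0 := by
    unfold mockBTerm
    refine ContinuousAt.div ?_ ?_ (by simpa using hne)
    · unfold qPoch
      fun_prop
    · unfold qPoch
      fun_prop
  simpa using hc.tendsto.mono_left nhdsWithin_le_nhds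

lemma mockBTerm_eq_zero (hK : Odd K) (hζ : IsPrimitiveRoot ζ (2 * K)) {n : ℕ} (hn : K ≤ n) :
    mockBTerm ζ n = 0 := by
  obtain ⟨m, hm⟩ := hK
  have : qPoch (-ζ) (ζ ^ 2) n = 0 := qPoch_eq_zero (j := m) (by omega) (by
    rw [← pow_mul, neg_mul, ← pow_succ', ← hm, pow_half_eq_neg_one (by omega) hζ, neg_neg])
  simp [mockBTerm, this]

theorem tendsto_mockB_radial (hK : Odd K) (hζ : IsPrimitiveRoot ζ (2 * K)) :
    Tendsto (fun t : ℝ ↦ mockB (ζ * (Real.exp (-t) : ℂ))) (𝓝[>] 0)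
      (𝓝 (lambertSum K (ζ ^ 2) ζ)) := by
  have hK0 := hK.pos
  have hζ0 : ζ ≠ 0 := hζ.ne_zero (by omega)
  have hlim : lambertSum K (ζ ^ 2) ζ = ∑ n ∈ Finset.range (K + K), mockBTerm ζ n := by
    rw [Finset.sum_range_add, Finset.sum_eq_zero (f := fun n ↦ mockBTerm ζ (K + n))
      (fun n _ ↦ mockBTerm_eq_zero hK hζ (by omega)), add_zero, lambertSum]
    refine Finset.sum_congr rfl fun n _ ↦ ?_
    rw [mockBTerm, sq, mul_div_cancel_right₀ _ hζ0]
  have hfin : Tendsto (fun t : ℝ ↦ ∑ n ∈ Finset.range (K + K),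
      mockBTerm (ζ * (Real.exp (-t) : ℂ)) n) (𝓝[>] 0) (𝓝 (lambertSum K (ζ ^ 2) ζ)) := by
    rw [hlim]
    exact tendsto_finsetSum _ fun n _ ↦ tendsto_mockBTerm hζ n
  have hquot : ∀ n, Tendsto (fun t : ℝ ↦
      ‖mockBTerm (ζ * (Real.exp (-t) : ℂ)) (n + (K + K))‖ / (1 - (1 - t / 4))) (𝓝[>] 0)
      (𝓝 0) := by
    intro n
    obtain ⟨c, hc⟩ := norm_mockBTerm_add_le_mul hK hζ (n + K)
    have h0 : Tendsto (fun t : ℝ ↦ 4 * c * ‖mockBTerm (ζ * (Real.exp (-t) : ℂ)) (n + K)‖)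
        (𝓝[>] 0) (𝓝 0) := by
      have := (tendsto_mockBTerm hζ (n + K)).norm.const_mul (4 * c)
      rwa [mockBTerm_eq_zero hK hζ (by omega), norm_zero, mul_zero] at this
    refine squeeze_zero' ?_ ?_ h0
    · filter_upwards [self_mem_nhdsWithin] with t ht
      have ht : 0 < t := ht
      have : 0 < 1 - (1 - t / 4) := by linarith
      positivity
    · filter_upwards [self_mem_nhdsWithin, hc] with t ht hct
      have ht : 0 < t := ht
      rw [div_le_iff₀ (by linarith), ← add_assoc]
      linarith
  have htail : Tendsto (fun t : ℝ ↦ ∑' n, mockBTerm (ζ * (Real.exp (-t) : ℂ)) (n + (K + K)))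
      (𝓝[>] 0) (𝓝 0) := by
    have hsum := tendsto_finsetSum (Finset.range K) fun n _ ↦ hquot n
    rw [Finset.sum_const_zero] at hsum
    refine squeeze_zero_norm' ?_ hsum
    filter_upwards [norm_mockBTerm_add_le hK hζ, Ioo_mem_nhdsGT one_pos] with t hle ht
    have hb := sum_range_le_of_norm_add_le (K := K) (ρ := 1 - t / 4)
      (by linarith [ht.1]) (a := fun n ↦ mockBTerm (ζ * (Real.exp (-t) : ℂ)) (n + (K + K)))
      (fun n ↦ by
        have := hle (n + (K + K))
        rwa [add_right_comm] at this)
    have hs := summable_of_sum_range_le (fun _ ↦ norm_nonneg _) hb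
    refine (norm_tsum_le_tsum_norm hs).trans ?_
    rw [← Finset.sum_div]
    exact Real.tsum_le_of_sum_range_le (fun _ ↦ norm_nonneg _) hb
  have htot := hfin.add htail
  rw [add_zero] at htot
  refine htot.congr' ?_
  filter_upwards [norm_mockBTerm_add_le hK hζ, Ioo_mem_nhdsGT one_pos] with t hle ht
  have hs : Summable (mockBTerm (ζ * (Real.exp (-t) : ℂ))) :=
    .of_norm (summable_of_sum_range_le (fun _ ↦ norm_nonneg _)
      (sum_range_le_of_norm_add_le (by linarith [ht.1]) hle))
  exact hs.sum_add_tsum_nat_add (K + K)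

end RadialLimit

lemma zeta_eq_exp (h k : ℕ) :
    zeta h k = Complex.exp (2 * Real.pi * Complex.I * ((h : ℂ) / (k : ℂ))) := by
  simp [zeta, ee]

lemma zeta_two_mul (h k : ℕ) : zeta (2 * (h : ℤ)) k = zeta h k ^ 2 := by
  rw [zeta_eq_exp, ← Complex.exp_nat_mul, zeta, ee]
  congr 1
  push_cast
  ring

lemma qT_eq (h k : ℕ) (t : ℝ) : qT h k t = zeta h k * (Real.exp (-t) : ℂ) := by
  rw [zeta_eq_exp, Complex.ofReal_exp, ← Complex.exp_add, qT, ee, tauT]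
  congr 1
  have : (Real.pi : ℂ) ≠ 0 := by exact_mod_cast Real.pi_ne_zero
  field_simp
  push_cast
  linear_combination (t : ℂ) * Complex.I_sq

/-- Lemma 6.1 (iii): radial limit of B at cusps with k ≡ 2 (mod 4). -/
theorem statement16 (h k : ℕ) (hk : 1 ≤ k) (h2 : k % 4 = 2) (hhk : h < k)
    (hghk : Nat.gcd h k = 1) :
    (∀ n : ℕ, n < k / 2 →
      qPoch (Complex.I * zeta h k) (-(zeta (2 * (h : ℤ)) k)) (n + 1) ≠ 0) ∧
    Filter.Tendsto (fun t : ℝ => mockB (qT h k t)) (𝓝[>] (0 : ℝ))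
      (𝓝 (Complex.I * ∑ n ∈ Finset.range (k / 2),
        (-1 : ℂ) ^ (n * (n + 1) / 2) * (zeta h k) ^ (n * (n + 1)) *
          qPoch (zeta (2 * (h : ℤ)) k) (-(zeta (2 * (h : ℤ)) k)) n /
          qPoch (Complex.I * zeta h k) (-(zeta (2 * (h : ℤ)) k)) (n + 1) ^ 2)) := by
  obtain ⟨K, rfl⟩ : ∃ K, k = 2 * K := ⟨k / 2, by omega⟩
  have hK : Odd K := Nat.odd_iff.mpr (by omega)
  have hζ : IsPrimitiveRoot (zeta h (2 * K)) (2 * K) := by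
    rw [zeta_eq_exp]
    exact Complex.isPrimitiveRoot_exp_of_coprime h (2 * K) (by omega) hghk
  rw [zeta_two_mul, Nat.mul_div_cancel_left K two_pos]
  simp only [qT_eq]
  set ζ := zeta h (2 * K)
  have hζ2 : (ζ ^ 2) ^ K = 1 := by rw [← pow_mul, hζ.pow_eq_one]
  refine ⟨fun n _ ↦ qPoch_ne_zero (fun j hj ↦ ?_) _, ?_⟩
  · have hsq : -(ζ ^ 2) ^ (2 * j + 1) = 1 := by
      have hs : ((-1 : ℂ) ^ j) ^ 2 = 1 := by rw [← pow_mul, mul_comm, pow_mul]; norm_num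
      rw [neg_pow] at hj
      calc -(ζ ^ 2) ^ (2 * j + 1) = (Complex.I * ζ * ((-1) ^ j * (ζ ^ 2) ^ j)) ^ 2 := by
            linear_combination (-(ζ ^ 2) ^ (2 * j + 1)) *
              (((-1 : ℂ) ^ j) ^ 2 * Complex.I_sq - hs)
        _ = 1 := by rw [hj, one_pow]
    have := congrArg (· ^ K) hsq
    simp only [hK.neg_pow, one_pow, ← pow_mul _ (2 * j + 1), mul_comm _ K] at this
    rw [pow_mul, hζ2, one_pow] at this
    norm_num at this
  · have hsum : ∑ n ∈ Finset.range K, (-1 : ℂ) ^ (n * (n + 1) / 2) * ζ ^ (n * (n + 1)) *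
        qPoch (ζ ^ 2) (-ζ ^ 2) n / qPoch (Complex.I * ζ) (-ζ ^ 2) (n + 1) ^ 2 =
        eulerSum K (-ζ ^ 2) (Complex.I * ζ) := by
      have hdiv : -ζ ^ 2 / (Complex.I * ζ) = Complex.I * ζ := by
        rw [div_eq_iff (mul_ne_zero Complex.I_ne_zero (hζ.ne_zero (by omega)))]
        linear_combination (-ζ ^ 2) * Complex.I_sq
      refine Finset.sum_congr rfl fun n _ ↦ ?_
      rw [hdiv, neg_neg, neg_pow (ζ ^ 2) (n * (n + 1) / 2), ← pow_mul ζ 2,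
        Nat.mul_div_cancel' (Nat.even_mul_succ_self n).two_dvd, sq (qPoch _ _ _)]
    rw [hsum, ← lambertSum_eq_eulerSum hK hζ]
    exact tendsto_mockB_radial hK hζ

end
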